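/- arXiv:1408.1360 — 4 statements merged into one kernel-verified Lean document; each statement's English description precedes it below -/
import Mathlib

section
/- For all real numbers κ₃, κ₄ and every x ∈ (−2, 2), writing G = G_ω(x) = (x − i√(4 − x²))/2 and p_ω(x) = √(4 − x²)/(2π), one has −(1/π)·Im( (κ₄ − κ₃²)·G⁵/(1 − G²) + κ₃²·( G⁷/(1 − G²)² + G⁵/(1 − G²)³ ) ) = −( κ₄(x⁶ − 8x⁴ + 18x² − 8) − κ₃²(2x⁶ − 15x⁴ + 30x² − 10) )·p_ω(x)/(4 − x²)². -/
/-- The boundary value on `(-2,2)` of the Cauchy transform of the semicircle law: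
`G_ω(x) = (x - i√(4 - x²))/2`. -/
noncomputable def Gsc (x : ℝ) : ℂ :=
  ((x : ℂ) - Complex.I * (Real.sqrt (4 - x ^ 2) : ℝ)) / 2

/-- The standard semicircle density `p_ω(x) = √(4 - x²)/(2π)`. -/
noncomputable def psc (x : ℝ) : ℝ := Real.sqrt (4 - x ^ 2) / (2 * Real.pi)

/-- Stieltjes inversion of the `n^{-1}` term of the Cauchy-transform expansion. -/
theorem stmt11 (κ₃ κ₄ : ℝ) (x : ℝ) (hx : x ∈ Set.Ioo (-2 : ℝ) 2) :
    -(1 / Real.pi) *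
        (((κ₄ : ℂ) - (κ₃ : ℂ) ^ 2) * Gsc x ^ 5 / (1 - Gsc x ^ 2)
          + (κ₃ : ℂ) ^ 2 * (Gsc x ^ 7 / (1 - Gsc x ^ 2) ^ 2
            + Gsc x ^ 5 / (1 - Gsc x ^ 2) ^ 3)).im
      = -(κ₄ * (x ^ 6 - 8 * x ^ 4 + 18 * x ^ 2 - 8)
          - κ₃ ^ 2 * (2 * x ^ 6 - 15 * x ^ 4 + 30 * x ^ 2 - 10))
        * psc x / (4 - x ^ 2) ^ 2 := by
  obtain ⟨h1, h2⟩ := hx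
  have hpos : 0 < 4 - x ^ 2 := by nlinarith
  have hs : 0 < Real.sqrt (4 - x ^ 2) := Real.sqrt_pos.mpr hpos
  have hsq : Real.sqrt (4 - x ^ 2) ^ 2 = 4 - x ^ 2 := Real.sq_sqrt hpos.le
  unfold psc
  have hG : Gsc x = ((x : ℂ) - Complex.I * (Real.sqrt (4 - x ^ 2) : ℝ)) / 2 := rfl
  rw [← hsq]
  rw [Real.sqrt_sq hs.le]
  generalize Real.sqrt (4 - x ^ 2) = s at *
  generalize Gsc x = G at *
  have hsC : (s : ℂ) ^ 2 = 4 - (x : ℂ) ^ 2 := by exact_mod_cast hsq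
  have hI : Complex.I ^ 2 = -1 := Complex.I_sq
  have hs0 : (s : ℂ) ≠ 0 := by exact_mod_cast hs.ne'
  have hG2 : G ^ 2 = x * G - 1 := by
    rw [hG]; linear_combination (1 / 4) * (s : ℂ) ^ 2 * hI - (1 / 4) * hsC
  have hG0 : G ≠ 0 := by
    intro h
    rw [h] at hG2
    norm_num at hG2
  have hD : 1 - G ^ 2 = G * (Complex.I * s) := by
    have h3 : Complex.I * (s : ℂ) = x - 2 * G := by rw [hG]; ring
    rw [h3]; linear_combination hG2
  have hI0 := Complex.I_ne_zero
  have hE : ((κ₄ : ℂ) - (κ₃ : ℂ) ^ 2) * G ^ 5 / (1 - G ^ 2)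
          + (κ₃ : ℂ) ^ 2 * (G ^ 7 / (1 - G ^ 2) ^ 2 + G ^ 5 / (1 - G ^ 2) ^ 3)
      = (((s ^ 3)⁻¹ : ℝ) : ℂ) * (-Complex.I * s ^ 2 * (κ₄ - κ₃ ^ 2) * G ^ 4
          + κ₃ ^ 2 * (-s * G ^ 5 + Complex.I * G ^ 2)) := by
    have e1 : G ^ 5 / (1 - G ^ 2) = -Complex.I * G ^ 4 / s := by
      rw [hD, div_eq_div_iff (by positivity) hs0]
      linear_combination G ^ 5 * s * hI
    have e2 : G ^ 7 / (1 - G ^ 2) ^ 2 = -G ^ 5 / s ^ 2 := by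
      rw [hD, div_eq_div_iff (by positivity) (by positivity)]
      linear_combination G ^ 7 * s ^ 2 * hI
    have e3 : G ^ 5 / (1 - G ^ 2) ^ 3 = Complex.I * G ^ 2 / s ^ 3 := by
      rw [hD, div_eq_div_iff (by positivity) (by positivity)]
      linear_combination -G ^ 5 * s ^ 3 * (Complex.I ^ 2 - 1) * hI
    rw [mul_div_assoc, e1, e2, e3]
    push_cast
    field_simp
  have hN : -Complex.I * s ^ 2 * (κ₄ - κ₃ ^ 2) * G ^ 4
          + κ₃ ^ 2 * (-s * G ^ 5 + Complex.I * G ^ 2)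
      = ((-s ^ 2 * (κ₄ - κ₃ ^ 2) * (x * (x ^ 3 - 2 * x) / 2 - (x ^ 2 - 1))
            + κ₃ ^ 2 * (s ^ 2 * (x ^ 4 - 3 * x ^ 2 + 1) / 2 + (x ^ 2 / 2 - 1)) : ℝ) : ℂ) * Complex.I
        + ((-s ^ 3 * (κ₄ - κ₃ ^ 2) * (x ^ 3 - 2 * x) / 2
            + κ₃ ^ 2 * (-s * ((x ^ 4 - 3 * x ^ 2 + 1) * x / 2 - (x ^ 3 - 2 * x)) + s * x / 2) : ℝ) : ℂ) := by
    have g4 : G ^ 4 = (x ^ 3 - 2 * x) * G - (x ^ 2 - 1) := by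
      linear_combination (G ^ 2 + x * G + x ^ 2 - 1) * hG2
    have g5 : G ^ 5 = (x ^ 4 - 3 * x ^ 2 + 1) * G - (x ^ 3 - 2 * x) := by
      linear_combination G * g4 + (x ^ 3 - 2 * x) * hG2
    rw [g4, g5, hG2, hG]
    push_cast
    linear_combination (s ^ 3 * (κ₄ - κ₃ ^ 2) * (x ^ 3 - 2 * x) / 2 - κ₃ ^ 2 * x * s / 2) * hI
  rw [hE, hN, Complex.im_ofReal_mul]
  simp only [Complex.add_im, Complex.mul_I_im, Complex.ofReal_re, Complex.ofReal_im, add_zero]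
  have hpi := Real.pi_ne_zero
  have hs' := hs.ne'
  field_simp
  rw [hsq]
  ring
end

section
/- For all real numbers κ₃, κ₄, κ₅ and every x ∈ (−2, 2), writing G = G_ω(x) = (x − i√(4 − x²))/2 and p_ω(x) = √(4 − x²)/(2π), one has −(1/π)·Im( κ₅·G⁶/(1 − G²) − κ₃κ₄·G⁸(5G² − 7)/(1 − G²)³ + κ₃³·G¹⁰(5G⁴ − 15G² + 12)/(1 − G²)⁵ ) = ( κ₅(x⁴ − 5x² + 5)x/(4 − x²) + κ₃κ₄(5x⁶ − 42x⁴ + 105x² − 70)x/(4 − x²)² + κ₃³(5x⁸ − 60x⁶ + 252x⁴ − 420x² + 210)x/(4 − x²)³ )·p_ω(x). -/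
/-- Stieltjes inversion of the `n^{-3/2}` term of the Cauchy-transform expansion. -/
theorem stmt12 (κ₃ κ₄ κ₅ : ℝ) (x : ℝ) (hx : x ∈ Set.Ioo (-2 : ℝ) 2) :
    -(1 / Real.pi) *
        ((κ₅ : ℂ) * Gsc x ^ 6 / (1 - Gsc x ^ 2)
          - (κ₃ : ℂ) * (κ₄ : ℂ) * Gsc x ^ 8 * (5 * Gsc x ^ 2 - 7)
              / (1 - Gsc x ^ 2) ^ 3
          + (κ₃ : ℂ) ^ 3 * Gsc x ^ 10 * (5 * Gsc x ^ 4 - 15 * Gsc x ^ 2 + 12)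
              / (1 - Gsc x ^ 2) ^ 5).im
      = (κ₅ * (x ^ 4 - 5 * x ^ 2 + 5) * x / (4 - x ^ 2)
          + κ₃ * κ₄ * (5 * x ^ 6 - 42 * x ^ 4 + 105 * x ^ 2 - 70) * x
              / (4 - x ^ 2) ^ 2
          + κ₃ ^ 3 * (5 * x ^ 8 - 60 * x ^ 6 + 252 * x ^ 4 - 420 * x ^ 2 + 210) * x
              / (4 - x ^ 2) ^ 3) * psc x := by
  have hpos : 0 < 4 - x ^ 2 := by nlinarith [hx.1, hx.2]
  have hspos : 0 < Real.sqrt (4 - x ^ 2) := Real.sqrt_pos.mpr hpos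
  have hs2 : Real.sqrt (4 - x ^ 2) ^ 2 = 4 - x ^ 2 := Real.sq_sqrt hpos.le
  have hGdef : Gsc x = ((x : ℂ) - Complex.I * (Real.sqrt (4 - x ^ 2) : ℝ)) / 2 := rfl
  unfold psc
  generalize Real.sqrt (4 - x ^ 2) = s at *
  generalize Gsc x = G at *
  rw [← hs2]
  have hsC : (s : ℂ) ^ 2 = 4 - (x : ℂ) ^ 2 := by exact_mod_cast hs2
  have hs0 : (s : ℂ) ≠ 0 := by exact_mod_cast hspos.ne'
  have h2 : G ^ 2 = x * G - 1 := by
    rw [hGdef]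
    linear_combination (-1 / 4 : ℂ) * hsC + (s : ℂ) ^ 2 / 4 * Complex.I_sq
  have hG0 : G ≠ 0 := by
    rintro rfl
    norm_num at h2
  have hD : 1 - G ^ 2 = G * (Complex.I * s) := by
    have h3 : Complex.I * s = x - 2 * G := by rw [hGdef]; ring
    rw [h3]; linear_combination h2
  have hG3 : G ^ 3 = ((x ^ 2 - 1 : ℝ) : ℂ) * G - (x : ℝ) := by
    push_cast; linear_combination (G + x) * h2
  have hG5 : G ^ 5 = ((x ^ 4 - 3 * x ^ 2 + 1 : ℝ) : ℂ) * G - ((x ^ 3 - 2 * x : ℝ) : ℂ) := by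
    have : G ^ 5 = G ^ 2 * G ^ 3 := by ring
    rw [this, hG3, h2]; push_cast
    linear_combination (x * (x ^ 2 - 1) : ℂ) * h2
  have hG7 : G ^ 7 = ((x ^ 6 - 5 * x ^ 4 + 6 * x ^ 2 - 1 : ℝ) : ℂ) * G
      - ((x ^ 5 - 4 * x ^ 3 + 3 * x : ℝ) : ℂ) := by
    have : G ^ 7 = G ^ 2 * G ^ 5 := by ring
    rw [this, hG5, h2]; push_cast
    linear_combination (x * (x ^ 4 - 3 * x ^ 2 + 1) : ℂ) * h2
  have hG9 : G ^ 9 = ((x ^ 8 - 7 * x ^ 6 + 15 * x ^ 4 - 10 * x ^ 2 + 1 : ℝ) : ℂ) * G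
      - ((x ^ 7 - 6 * x ^ 5 + 10 * x ^ 3 - 4 * x : ℝ) : ℂ) := by
    have : G ^ 9 = G ^ 2 * G ^ 7 := by ring
    rw [this, hG7, h2]; push_cast
    linear_combination (x * (x ^ 6 - 5 * x ^ 4 + 6 * x ^ 2 - 1) : ℂ) * h2
  have hre : G.re = x / 2 := by rw [hGdef]; simp
  have hE : (κ₅ : ℂ) * G ^ 6 / (1 - G ^ 2)
          - (κ₃ : ℂ) * (κ₄ : ℂ) * G ^ 8 * (5 * G ^ 2 - 7) / (1 - G ^ 2) ^ 3
          + (κ₃ : ℂ) ^ 3 * G ^ 10 * (5 * G ^ 4 - 15 * G ^ 2 + 12) / (1 - G ^ 2) ^ 5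
      = -Complex.I * (((κ₅ / s : ℝ) : ℂ) * G ^ 5
          + ((κ₃ * κ₄ / s ^ 3 : ℝ) : ℂ) * (((5 : ℝ) : ℂ) * G ^ 7 - ((7 : ℝ) : ℂ) * G ^ 5)
          + ((κ₃ ^ 3 / s ^ 5 : ℝ) : ℂ) * (((5 : ℝ) : ℂ) * G ^ 9 - ((15 : ℝ) : ℂ) * G ^ 7
            + ((12 : ℝ) : ℂ) * G ^ 5)) := by
    have hI : Complex.I ≠ 0 := Complex.I_ne_zero
    have e1 : (κ₅ : ℂ) * G ^ 6 / (1 - G ^ 2) = -Complex.I * (κ₅ / s * G ^ 5) := by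
      rw [hD, div_eq_iff (by simp [hG0, hs0])]
      field_simp
      rw [Complex.I_sq]; ring
    have e2 : (κ₃ : ℂ) * (κ₄ : ℂ) * G ^ 8 * (5 * G ^ 2 - 7) / (1 - G ^ 2) ^ 3
        = Complex.I * (κ₃ * κ₄ / s ^ 3 * (5 * G ^ 7 - 7 * G ^ 5)) := by
      rw [hD, div_eq_iff (by simp [hG0, hs0])]
      field_simp
      rw [Complex.I_pow_four]; ring
    have e3 : (κ₃ : ℂ) ^ 3 * G ^ 10 * (5 * G ^ 4 - 15 * G ^ 2 + 12) / (1 - G ^ 2) ^ 5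
        = -Complex.I * (κ₃ ^ 3 / s ^ 5 * (5 * G ^ 9 - 15 * G ^ 7 + 12 * G ^ 5)) := by
      have h6 : Complex.I ^ 6 = -1 := by
        rw [show Complex.I ^ 6 = (Complex.I ^ 2) ^ 3 by ring, Complex.I_sq]; norm_num
      rw [hD, div_eq_iff (by simp [hG0, hs0])]
      field_simp
      rw [h6]; ring
    rw [e1, e2, e3]; push_cast; ring
  rw [hE, hG5, hG7, hG9]
  simp only [neg_mul, Complex.neg_im, Complex.I_mul_im, Complex.add_re, Complex.sub_re,
    Complex.re_ofReal_mul, Complex.ofReal_re, hre]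
  have hsr : s ≠ 0 := hspos.ne'
  have hpi := Real.pi_ne_zero
  field_simp
  ring
end

section
/- For all real numbers κ₃, κ₄ and every x ∈ (−2, 2), the function x ↦ ( −κ₄·U₃(x/2) + 2κ₃²·( U₃(x/2) + U₁(x/2) − U₁(x/2)/(4 − x²) ) )·p_ω(x)/4 is differentiable at x with derivative −( κ₄(x⁶ − 8x⁴ + 18x² − 8) − κ₃²(2x⁶ − 15x⁴ + 30x² − 10) )·p_ω(x)/(4 − x²)², where p_ω(x) = √(4 − x²)/(2π). -/
/-- Chebyshev polynomials of the second kind: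
`U₀ = 1`, `U₁(y) = 2y`, `U_{n+1}(y) = 2y·U_n(y) - U_{n-1}(y)`. -/
def chebU : ℕ → ℝ → ℝ
  | 0, _ => 1
  | 1, y => 2 * y
  | (n + 2), y => 2 * y * chebU (n + 1) y - chebU n y

/-- Antiderivative identity for the order `n^{-1}` term of the density expansion. -/
theorem stmt14 (κ₃ κ₄ : ℝ) (x : ℝ) (hx : x ∈ Set.Ioo (-2 : ℝ) 2) :
    HasDerivAt (fun y : ℝ =>
        (-κ₄ * chebU 3 (y / 2)
          + 2 * κ₃ ^ 2 * (chebU 3 (y / 2) + chebU 1 (y / 2)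
            - chebU 1 (y / 2) / (4 - y ^ 2))) * psc y / 4)
      (-(κ₄ * (x ^ 6 - 8 * x ^ 4 + 18 * x ^ 2 - 8)
          - κ₃ ^ 2 * (2 * x ^ 6 - 15 * x ^ 4 + 30 * x ^ 2 - 10))
        * psc x / (4 - x ^ 2) ^ 2) x := by
  have hw : 0 < 4 - x ^ 2 := by nlinarith [hx.1, hx.2]
  have hw0 : 4 - x ^ 2 ≠ 0 := hw.ne'
  have hs : Real.sqrt (4 - x ^ 2) ≠ 0 := (Real.sqrt_pos.mpr hw).ne'
  have hsq : Real.sqrt (4 - x ^ 2) ^ 2 = 4 - x ^ 2 := Real.sq_sqrt hw.le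
  have hd : HasDerivAt (fun y : ℝ => 4 - y ^ 2) (-(2 * x)) x := by
    simpa using (hasDerivAt_pow 2 x).const_sub 4
  have hp : HasDerivAt psc (-x * psc x / (4 - x ^ 2)) x := by
    have h := (hd.sqrt hw0).div_const (2 * Real.pi)
    refine h.congr_deriv ?_
    unfold psc
    have hpi := Real.pi_ne_zero
    rw [← hsq]
    simp only [Real.sqrt_sq (Real.sqrt_nonneg _)]
    field_simp
  have h3 : HasDerivAt (fun y : ℝ => chebU 3 (y / 2)) (3 * x ^ 2 - 2) x := by
    have e : (fun y : ℝ => chebU 3 (y / 2)) = fun y => y ^ 3 - 2 * y := by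
      funext y
      simp only [chebU]
      ring
    rw [e]
    have h := (hasDerivAt_pow 3 x).sub ((hasDerivAt_id x).const_mul 2)
    refine h.congr_deriv ?_
    norm_num
  have h1 : HasDerivAt (fun y : ℝ => chebU 1 (y / 2)) 1 x := by
    have e : (fun y : ℝ => chebU 1 (y / 2)) = fun y => y := by
      funext y
      simp only [chebU]
      ring
    rw [e]
    exact hasDerivAt_id x
  have h := (((h3.const_mul (-κ₄)).add
    (((h3.add h1).sub (h1.div hd hw0)).const_mul (2 * κ₃ ^ 2))).mul hp).div_const 4
  refine h.congr_deriv ?_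
  simp only [chebU, Pi.add_apply, Pi.sub_apply, Pi.div_apply]
  field_simp
  ring
end

section
/- For all real numbers κ₃, κ₄, κ₅ and every x ∈ (−2, 2), the function x ↦ ( −(κ₅/5)·U₄(x/2) − (κ₃κ₄/(4 − x²))·( U₆(x/2) − U₄(x/2) ) − (κ₃³/(3(4 − x²)²))·( 3U₈(x/2) − 7U₆(x/2) + 4U₄(x/2) ) )·p_ω(x) is differentiable at x with derivative ( κ₅(x⁴ − 5x² + 5)x/(4 − x²) + κ₃κ₄(5x⁶ − 42x⁴ + 105x² − 70)x/(4 − x²)² + κ₃³(5x⁸ − 60x⁶ + 252x⁴ − 420x² + 210)x/(4 − x²)³ )·p_ω(x), where p_ω(x) = √(4 − x²)/(2π). -/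
theorem chebU_four (y : ℝ) : chebU 4 (y / 2) = y ^ 4 - 3 * y ^ 2 + 1 := by
  simp only [chebU]; ring

theorem chebU_six (y : ℝ) : chebU 6 (y / 2) = y ^ 6 - 5 * y ^ 4 + 6 * y ^ 2 - 1 := by
  simp only [chebU]; ring

theorem chebU_eight (y : ℝ) :
    chebU 8 (y / 2) = y ^ 8 - 7 * y ^ 6 + 15 * y ^ 4 - 10 * y ^ 2 + 1 := by
  simp only [chebU]; ring

/-- Antiderivative identity for the order `n^{-3/2}` term of the density expansion. -/
theorem stmt15 (κ₃ κ₄ κ₅ : ℝ) (x : ℝ) (hx : x ∈ Set.Ioo (-2 : ℝ) 2) :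
    HasDerivAt (fun y : ℝ =>
        (-(κ₅ / 5) * chebU 4 (y / 2)
          - (κ₃ * κ₄ / (4 - y ^ 2)) * (chebU 6 (y / 2) - chebU 4 (y / 2))
          - (κ₃ ^ 3 / (3 * (4 - y ^ 2) ^ 2)) *
              (3 * chebU 8 (y / 2) - 7 * chebU 6 (y / 2) + 4 * chebU 4 (y / 2)))
          * psc y)
      ((κ₅ * (x ^ 4 - 5 * x ^ 2 + 5) * x / (4 - x ^ 2)
          + κ₃ * κ₄ * (5 * x ^ 6 - 42 * x ^ 4 + 105 * x ^ 2 - 70) * x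
              / (4 - x ^ 2) ^ 2
          + κ₃ ^ 3 * (5 * x ^ 8 - 60 * x ^ 6 + 252 * x ^ 4 - 420 * x ^ 2 + 210) * x
              / (4 - x ^ 2) ^ 3) * psc x) x := by
  have hs : 0 < 4 - x ^ 2 := by nlinarith [hx.1, hx.2]
  have hs0 : 4 - x ^ 2 ≠ 0 := hs.ne'
  have hP : ∀ n : ℕ, HasDerivAt (fun y : ℝ => y ^ n) (n * x ^ (n - 1)) x :=
    fun n => hasDerivAt_pow n x
  have h4 : HasDerivAt (fun y : ℝ => chebU 4 (y / 2)) (4 * x ^ 3 - 6 * x) x := by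
    simp only [chebU_four]
    refine (((hP 4).sub ((hP 2).const_mul 3)).add_const 1).congr_deriv ?_
    norm_num; ring
  have h6 : HasDerivAt (fun y : ℝ => chebU 6 (y / 2)) (6 * x ^ 5 - 20 * x ^ 3 + 12 * x) x := by
    simp only [chebU_six]
    refine ((((hP 6).sub ((hP 4).const_mul 5)).add ((hP 2).const_mul 6)).sub_const 1).congr_deriv ?_
    norm_num; ring
  have h8 : HasDerivAt (fun y : ℝ => chebU 8 (y / 2))
      (8 * x ^ 7 - 42 * x ^ 5 + 60 * x ^ 3 - 20 * x) x := by
    simp only [chebU_eight]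
    refine (((((hP 8).sub ((hP 6).const_mul 7)).add ((hP 4).const_mul 15)).sub
      ((hP 2).const_mul 10)).add_const 1).congr_deriv ?_
    norm_num; ring
  have hd : HasDerivAt (fun y : ℝ => 4 - y ^ 2) (-(2 * x)) x := by
    refine ((hP 2).const_sub 4).congr_deriv ?_
    norm_num
  have hp : HasDerivAt psc (-x / (4 - x ^ 2) * psc x) x := by
    refine ((hd.sqrt hs0).div_const (2 * Real.pi)).congr_deriv ?_
    have hq : Real.sqrt (4 - x ^ 2) ≠ 0 := (Real.sqrt_pos.mpr hs).ne'
    have hq2 : Real.sqrt (4 - x ^ 2) ^ 2 = 4 - x ^ 2 := Real.sq_sqrt hs.le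
    have hpi := Real.pi_ne_zero
    unfold psc
    nth_rewrite 2 [← hq2]
    field_simp
  have hA := h4.const_mul (-(κ₅ / 5))
  have hB := ((hasDerivAt_const x (κ₃ * κ₄)).fun_div hd hs0).fun_mul (h6.fun_sub h4)
  have hC := ((hasDerivAt_const x (κ₃ ^ 3)).fun_div ((hd.fun_pow 2).const_mul 3)
    (mul_ne_zero three_ne_zero (pow_ne_zero 2 hs0))).fun_mul
    (((h8.const_mul 3).fun_sub (h6.const_mul 7)).fun_add (h4.const_mul 4))
  refine (((hA.fun_sub hB).fun_sub hC).fun_mul hp).congr_deriv ?_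
  rw [← mul_assoc _ (-x / (4 - x ^ 2)) (psc x), ← add_mul]
  congr 1
  simp only [chebU_four, chebU_six, chebU_eight]
  push_cast
  field_simp
  ring
end
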